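/- arXiv:2509.10294 — 2 statements merged into one kernel-verified Lean document; each statement's English description precedes it below -/
import Mathlib

section
/- Suppose |ℱ| < n. Then either there are at least (n + 1 − |ℱ|)/2 elements i ∈ [n] such that i ∈ M for some M ∈ ℳ, or there are at least (n + 1 − |ℱ|)/2 elements i ∈ [n] such that i ∉ N for some N ∈ 𝒩. -/
open Finset

/-- A family `F` of subsets of `[n]` (as subsets of `Fin n`) contains an induced copy of
the finite poset `P`: there is an injection `f : P → F` with `a ≤ b ↔ f a ⊆ f b`. -/
def ContainsCopy (P : Type) [PartialOrder P] {n : ℕ}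
    (F : Set (Finset (Fin n))) : Prop :=
  ∃ f : P → Finset (Fin n), Function.Injective f ∧ (∀ a, f a ∈ F) ∧
    ∀ a b : P, a ≤ b ↔ f a ⊆ f b

/-- `F` is `P`-saturated: it contains no induced copy of `P`, but adding any new set
creates one. -/
def IsSaturated (P : Type) [PartialOrder P] {n : ℕ}
    (F : Finset (Finset (Fin n))) : Prop :=
  ¬ ContainsCopy P (↑F : Set (Finset (Fin n))) ∧
    ∀ S : Finset (Fin n), S ∉ F →
      ContainsCopy P (insert S (↑F : Set (Finset (Fin n))))

/-- The induced saturation number `sat*(n, P)`. -/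
noncomputable def satStar (n : ℕ) (P : Type) [PartialOrder P] : ℕ :=
  sInf {m | ∃ F : Finset (Finset (Fin n)), IsSaturated P F ∧ F.card = m}

/-- The antichain poset `𝒜_k` with `k` elements. -/
def AC (k : ℕ) : Type := Fin k

instance (k : ℕ) : PartialOrder (AC k) where
  le a b := a = b
  le_refl _ := rfl
  le_trans _ _ _ h₁ h₂ := Eq.trans h₁ h₂
  le_antisymm _ _ h _ := h

instance (k : ℕ) : Fintype (AC k) := inferInstanceAs (Fintype (Fin k))

/-- `ℳ₀`: members of `F` whose down-set in `F` contains an induced copy of `P₂`. -/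
def Mzero (P₂ : Type) [PartialOrder P₂] {n : ℕ} (F : Finset (Finset (Fin n))) :
    Set (Finset (Fin n)) :=
  {A | A ∈ F ∧ ContainsCopy P₂ {X | X ∈ F ∧ X ⊆ A}}

/-- `ℳ`: the minimal elements of `ℳ₀`. -/
def Mfam (P₂ : Type) [PartialOrder P₂] {n : ℕ} (F : Finset (Finset (Fin n))) :
    Set (Finset (Fin n)) :=
  {A ∈ Mzero P₂ F | ∀ B ∈ Mzero P₂ F, B ⊆ A → B = A}

/-- `𝒩₀`: members of `F` whose up-set in `F` contains an induced copy of `P₁`. -/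
def Nzero (P₁ : Type) [PartialOrder P₁] {n : ℕ} (F : Finset (Finset (Fin n))) :
    Set (Finset (Fin n)) :=
  {A | A ∈ F ∧ ContainsCopy P₁ {X | X ∈ F ∧ A ⊆ X}}

/-- `𝒩`: the maximal elements of `𝒩₀`. -/
def Nfam (P₁ : Type) [PartialOrder P₁] {n : ℕ} (F : Finset (Finset (Fin n))) :
    Set (Finset (Fin n)) :=
  {A ∈ Nzero P₁ F | ∀ B ∈ Nzero P₁ F, A ⊆ B → A = B}

section Cube

variable {α : Type*} [DecidableEq α]

/-- A family of sets that has an edge of the cube in each direction `i ∈ W` has more than `#W`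
members. -/
theorem card_lt_card_of_forall_insert_mem (W : Finset α) (F : Finset (Finset α))
    (hne : F.Nonempty) (h : ∀ i ∈ W, ∃ C ∈ F, i ∉ C ∧ insert i C ∈ F) : W.card < F.card := by
  induction W using Finset.induction_on generalizing F with
  | empty => simpa using hne
  | insert a W ha ih =>
    have hlt : (F.image fun C => C.erase a).card < F.card := by
      refine lt_of_le_of_ne card_image_le fun heq => ?_
      obtain ⟨C, hC, haC, hCa⟩ := h a (mem_insert_self a W)
      have hCeq : insert a C = C :=
        card_image_iff.mp heq hCa hC (by simp [erase_insert haC, erase_eq_of_notMem haC])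
      exact haC (hCeq ▸ mem_insert_self a C)
    have hW : W.card < (F.image fun C => C.erase a).card := by
      refine ih _ (hne.image _) fun i hi => ?_
      obtain ⟨C, hC, hiC, hCi⟩ := h i (mem_insert_of_mem hi)
      have hia : i ≠ a := fun e => ha (e ▸ hi)
      refine ⟨C.erase a, mem_image_of_mem _ hC, fun hmem => hiC (mem_of_mem_erase hmem), ?_⟩
      rw [← erase_insert_of_ne hia]
      exact mem_image_of_mem _ hCi
    rw [card_insert_of_notMem ha]
    omega

end Cube

section Saturated

variable {n : ℕ} {P₁ P₂ : Type} [PartialOrder P₁] [PartialOrder P₂] {k : ℕ}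
  {F : Finset (Finset (Fin n))}

theorem Mzero_mono {A B : Finset (Fin n)} (hA : A ∈ Mzero P₂ F) (hB : B ∈ F) (hAB : A ⊆ B) :
    B ∈ Mzero P₂ F := by
  obtain ⟨-, f, hf, hfF, hle⟩ := hA
  exact ⟨hB, f, hf, fun a => ⟨(hfF a).1, (hfF a).2.trans hAB⟩, hle⟩

theorem exists_mem_Mfam_subset {A : Finset (Fin n)} (hA : A ∈ Mzero P₂ F) :
    ∃ M ∈ Mfam P₂ F, M ⊆ A := by
  obtain ⟨M, hMA, hM⟩ := (Set.toFinite (Mzero P₂ F)).exists_le_minimal hA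
  exact ⟨M, ⟨hM.prop, fun B hB hBM => hM.eq_of_le hB hBM⟩, hMA⟩

/-- An antichain of size `k` in `F` strictly between a member of `ℳ₀` and a member of `𝒩₀`
gives a copy of the linear sum. -/
theorem containsCopy_of_antichain {A : Fin k → Finset (Fin n)} {Z Y : Finset (Fin n)}
    (hAF : ∀ j, A j ∈ F) (hA : ∀ j l, A j ⊆ A l → j = l)
    (hZ : Z ∈ Mzero P₂ F) (hY : Y ∈ Nzero P₁ F)
    (hZA : ∀ j, Z ⊂ A j) (hAY : ∀ j, A j ⊂ Y) (hZY : Z ⊂ Y) :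
    ContainsCopy (P₂ ⊕ₗ (AC k ⊕ₗ P₁)) (↑F : Set (Finset (Fin n))) := by
  obtain ⟨-, f, -, hfF, hf⟩ := hZ
  obtain ⟨-, g, -, hgF, hg⟩ := hY
  let e : P₂ ⊕ₗ (AC k ⊕ₗ P₁) → Finset (Fin n) := fun x =>
    Sum.elim f (fun y => Sum.elim (fun j : AC k => A j) g (ofLex y)) (ofLex x)
  have hfA : ∀ p j, f p ⊂ A j := fun p j => (hfF p).2.trans_ssubset (hZA j)
  have hAg : ∀ j p, A j ⊂ g p := fun j p => (hAY j).trans_subset (hgF p).2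
  have hfg : ∀ p q, f p ⊂ g q := fun p q => ((hfF p).2.trans_ssubset hZY).trans_subset (hgF q).2
  have he : ∀ a b, a ≤ b ↔ e a ⊆ e b := by
    rintro (p | (j | q)) (p' | (j' | q'))
    · exact Sum.Lex.inl_le_inl_iff.trans (hf p p')
    · exact iff_of_true (Sum.Lex.inl_le_inr _ _) (hfA p j').1
    · exact iff_of_true (Sum.Lex.inl_le_inr _ _) (hfg p q').1
    · exact iff_of_false Sum.Lex.not_inr_le_inl (hfA p' j).2
    · exact (Sum.Lex.inr_le_inr_iff.trans Sum.Lex.inl_le_inl_iff).trans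
        ⟨fun h => (congrArg A h).subset, hA j j'⟩
    · exact iff_of_true (Sum.Lex.inr_le_inr_iff.mpr (Sum.Lex.inl_le_inr _ _)) (hAg j q').1
    · exact iff_of_false Sum.Lex.not_inr_le_inl (hfg p' q).2
    · exact iff_of_false (fun h => Sum.Lex.not_inr_le_inl (Sum.Lex.inr_le_inr_iff.mp h))
        (hAg j' q).2
    · exact (Sum.Lex.inr_le_inr_iff.trans Sum.Lex.inr_le_inr_iff).trans (hg q q')
  refine ⟨e, fun a b hab => ?_, ?_, he⟩
  · exact le_antisymm ((he a b).mpr hab.subset) ((he b a).mpr hab.symm.subset)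
  · rintro (p | (j | q))
    · exact (hfF p).1
    · exact hAF j
    · exact (hgF q).1

/-- The possible positions of a new set `S` in a copy of the linear sum in `F ∪ {S}`. -/
theorem exists_antichain_of_containsCopy [Fintype P₁] [Fintype P₂]
    (hP₁ : ∃! a : P₁, IsMin a) (hP₂ : ∃! a : P₂, IsMax a) {S : Finset (Fin n)}
    (hF : ¬ ContainsCopy (P₂ ⊕ₗ (AC k ⊕ₗ P₁)) (↑F : Set (Finset (Fin n))))
    (hS : ContainsCopy (P₂ ⊕ₗ (AC k ⊕ₗ P₁)) (insert S (↑F : Set (Finset (Fin n))))) :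
    ∃ A : Fin k → Finset (Fin n), (∀ j l, A j ⊆ A l → j = l) ∧
      (((∀ j, A j ∈ F) ∧ ∃ Y ∈ Nzero P₁ F, S ⊂ Y ∧ ∀ j, S ⊂ A j ∧ A j ⊂ Y) ∨
      ((∀ j, A j ∈ F) ∧ ∃ Z ∈ Mzero P₂ F, Z ⊂ S ∧ ∀ j, Z ⊂ A j ∧ A j ⊂ S) ∨
      ∃ j₀, A j₀ = S ∧ (∀ j, j ≠ j₀ → A j ∈ F) ∧
        ∃ Z ∈ Mzero P₂ F, ∃ Y ∈ Nzero P₁ F, ∀ j, Z ⊂ A j ∧ A j ⊂ Y) := by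
  obtain ⟨b, hb, hbu⟩ := hP₁
  obtain ⟨t, ht, htu⟩ := hP₂
  have hbot : ∀ p : P₁, b ≤ p := fun p => by
    obtain ⟨m, hmp, hm⟩ := (Set.toFinite (Set.univ : Set P₁)).exists_le_minimal (Set.mem_univ p)
    rwa [hbu m (minimal_true.mp (by simpa using hm))] at hmp
  have htop : ∀ p : P₂, p ≤ t := fun p => by
    obtain ⟨m, hpm, hm⟩ := (Set.toFinite (Set.univ : Set P₂)).exists_le_maximal (Set.mem_univ p)
    rwa [htu m (maximal_true.mp (by simpa using hm))] at hpm
  obtain ⟨f, hinj, hfS, hle⟩ := hS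
  have hlt : ∀ {x y}, x < y → f x ⊂ f y := fun {x y} h =>
    ⟨(hle x y).mp h.le, fun h' => h.not_ge ((hle y x).mpr h')⟩
  let lo : P₂ → P₂ ⊕ₗ (AC k ⊕ₗ P₁) := fun p => toLex (Sum.inl p)
  let mid : AC k → P₂ ⊕ₗ (AC k ⊕ₗ P₁) := fun j => toLex (Sum.inr (toLex (Sum.inl j)))
  let hi : P₁ → P₂ ⊕ₗ (AC k ⊕ₗ P₁) := fun q => toLex (Sum.inr (toLex (Sum.inr q)))
  have hlo_mid : ∀ p j, f (lo p) ⊂ f (mid j) := fun p j => hlt (Sum.Lex.inl_lt_inr _ _)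
  have hlo_hi : ∀ p q, f (lo p) ⊂ f (hi q) := fun p q => hlt (Sum.Lex.inl_lt_inr _ _)
  have hmid_hi : ∀ j q, f (mid j) ⊂ f (hi q) := fun j q =>
    hlt (Sum.Lex.inr_lt_inr_iff.mpr (Sum.Lex.inl_lt_inr _ _))
  have hlo_le : ∀ p p', p ≤ p' ↔ f (lo p) ⊆ f (lo p') := fun p p' =>
    Sum.Lex.inl_le_inl_iff.symm.trans (hle _ _)
  have hhi_le : ∀ q q', q ≤ q' ↔ f (hi q) ⊆ f (hi q') := fun q q' =>
    (Sum.Lex.inr_le_inr_iff.trans Sum.Lex.inr_le_inr_iff).symm.trans (hle _ _)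
  have hmid_le : ∀ j j', f (mid j) ⊆ f (mid j') → j = j' := fun j j' h =>
    (Sum.Lex.inr_le_inr_iff.trans Sum.Lex.inl_le_inl_iff).mp ((hle (mid j) (mid j')).mpr h)
  obtain ⟨x, hx⟩ : ∃ x, f x = S := by
    by_contra! hno
    exact hF ⟨f, hinj, fun a => (hfS a).resolve_left (hno a), hle⟩
  have hmem : ∀ y, y ≠ x → f y ∈ F := fun y hy =>
    (hfS y).resolve_left fun h => hy (hinj (h.trans hx.symm))
  have hZ : (∀ p, lo p ≠ x) → f (lo t) ∈ Mzero P₂ F := fun h =>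
    ⟨hmem _ (h t), fun p => f (lo p), fun p p' e => Sum.inl_injective (hinj e),
      fun p => ⟨hmem _ (h p), (hlo_le p t).mp (htop p)⟩, hlo_le⟩
  have hY : (∀ q, hi q ≠ x) → f (hi b) ∈ Nzero P₁ F := fun h =>
    ⟨hmem _ (h b), fun q => f (hi q),
      fun q q' e => le_antisymm ((hhi_le _ _).mpr e.subset) ((hhi_le _ _).mpr e.symm.subset),
      fun q => ⟨hmem _ (h q), (hhi_le b q).mp (hbot q)⟩, hhi_le⟩
  have hne₁ : ∀ p j, lo p ≠ mid j := fun p j e => (hlo_mid p j).ne (congrArg f e)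
  have hne₂ : ∀ p q, lo p ≠ hi q := fun p q e => (hlo_hi p q).ne (congrArg f e)
  have hne₃ : ∀ j q, mid j ≠ hi q := fun j q e => (hmid_hi j q).ne (congrArg f e)
  refine ⟨fun j => f (mid j), hmid_le, ?_⟩
  obtain p | (j₀ | q) := x
  · refine Or.inl ⟨fun j => hmem _ (hne₁ p j).symm, f (hi b), hY fun q => (hne₂ p q).symm, ?_⟩
    rw [← hx]
    exact ⟨hlo_hi p b, fun j => ⟨hlo_mid p j, hmid_hi j b⟩⟩
  · exact Or.inr (Or.inr ⟨j₀, hx,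
      fun j hj => hmem _ fun e => hj (hmid_le j j₀ (congrArg f e).subset),
      f (lo t), hZ fun p => hne₁ p j₀, f (hi b), hY fun q => (hne₃ j₀ q).symm,
      fun j => ⟨hlo_mid t j, hmid_hi j b⟩⟩)
  · refine Or.inr (Or.inl ⟨fun j => hmem _ (hne₃ j q), f (lo t), hZ fun p => hne₂ p q, ?_⟩)
    rw [← hx]
    exact ⟨hlo_hi t q, fun j => ⟨hlo_mid t j, hmid_hi j q⟩⟩

theorem Mzero_nonempty_of_isSaturated [Fintype P₁] [Fintype P₂] (hk : 2 ≤ k)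
    (hP₁ : ∃! a : P₁, IsMin a) (hP₂ : ∃! a : P₂, IsMax a)
    (hF : IsSaturated (P₂ ⊕ₗ (AC k ⊕ₗ P₁)) F) (hcard : F.card < n) :
    (Mzero P₂ F).Nonempty := by
  by_contra hempty
  rw [Set.not_nonempty_iff_eq_empty] at hempty
  have hcoatom : ∀ i : Fin n, univ.erase i ∈ F := by
    intro i
    by_contra hS
    obtain ⟨A, hA, ⟨-, Y, -, -, h⟩ | ⟨-, Z, hZ, -⟩ | ⟨-, -, -, Z, hZ, -⟩⟩ :=
      exists_antichain_of_containsCopy hP₁ hP₂ hF.1 (hF.2 _ hS)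
    · have huniv : ∀ j, A j = univ := fun j => by
        have h1 := card_lt_card (h j).1
        rw [card_erase_of_mem (mem_univ i), card_univ, Fintype.card_fin] at h1
        rw [← card_eq_iff_eq_univ, Fintype.card_fin]
        have h2 := card_le_univ (A j)
        rw [Fintype.card_fin] at h2
        omega
      have h01 := hA ⟨0, by omega⟩ ⟨1, by omega⟩ (by rw [huniv, huniv])
      simp at h01
    · simp [hempty] at hZ
    · simp [hempty] at hZ
  have hle : (univ : Finset (Fin n)).card ≤ F.card :=
    card_le_card_of_injOn (fun i => univ.erase i) (fun i _ => hcoatom i)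
      fun i _ j _ hij => by simpa using congrArg (i ∈ ·) hij
  simp at hle
  omega

theorem exists_insert_mem_of_forall_notMem [Fintype P₁] [Fintype P₂] (hk : 2 ≤ k)
    (hP₁ : ∃! a : P₁, IsMin a) (hP₂ : ∃! a : P₂, IsMax a)
    (hF : IsSaturated (P₂ ⊕ₗ (AC k ⊕ₗ P₁)) F) (hne : (Mzero P₂ F).Nonempty)
    {i : Fin n} (hi : ∀ M ∈ Mfam P₂ F, i ∉ M) :
    ∃ C ∈ F, i ∉ C ∧ insert i C ∈ F := by
  by_contra! hno
  have : Nontrivial (Fin k) := Fin.nontrivial_iff_two_le.mpr hk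
  let G : Set (Finset (Fin n)) := {C | C ∈ Mzero P₂ F ∧ i ∉ C ∧ ∃ Y ∈ Nzero P₁ F, insert i C ⊆ Y}
  have hG : G.Nonempty := by
    obtain ⟨M, hM, -⟩ := exists_mem_Mfam_subset hne.some_mem
    have hZM : ∀ Z ∈ Mzero P₂ F, Z ⊂ insert i M → Z = M := by
      intro Z hZ hZS
      obtain ⟨M', hM', hM'Z⟩ := exists_mem_Mfam_subset hZ
      have hM'M : M' = M :=
        hM.2 _ hM'.1 ((subset_insert_iff_of_notMem (hi M' hM')).mp (hM'Z.trans hZS.1))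
      rw [hM'M] at hM'Z
      by_cases hiZ : i ∈ Z
      · exact absurd (insert_subset hiZ hM'Z) hZS.2
      · exact hM.2 _ hZ ((subset_insert_iff_of_notMem hiZ).mp hZS.1)
    obtain ⟨A, hA, ⟨hAF, Y, hY, hSY, h⟩ | ⟨hAF, Z, hZ, hZS, h⟩ | ⟨j₀, hj₀, hAF, Z, hZ, Y, hY, h⟩⟩ :=
      exists_antichain_of_containsCopy hP₁ hP₂ hF.1 (hF.2 _ (hno M hM.1.1 (hi M hM)))
    · exact absurd (containsCopy_of_antichain hAF hA hM.1 hY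
        (fun j => (subset_insert i M).trans_ssubset (h j).1) (fun j => (h j).2)
        ((subset_insert i M).trans_ssubset hSY)) hF.1
    · obtain ⟨hZA, hAS⟩ := h (Classical.arbitrary _)
      exact absurd ((hZM Z hZ hZS).trans
        (hZM _ (Mzero_mono hZ (hAF _) hZA.1) hAS).symm) hZA.ne
    · obtain ⟨j, hj⟩ := exists_ne j₀
      have hSY : insert i M ⊂ Y := hj₀ ▸ (h j₀).2
      have hMZ : Z = M := hZM Z hZ (hj₀ ▸ (h j₀).1)
      refine ⟨A j, Mzero_mono hZ (hAF j hj) (h j).1.1, fun hiA => hj ?_, Y, hY,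
        insert_subset (hSY.1 (mem_insert_self i M)) (h j).2.1⟩
      exact (hA j₀ j (hj₀ ▸ insert_subset hiA (hMZ ▸ (h j).1.1))).symm
  obtain ⟨C, hC⟩ := (Set.toFinite G).exists_maximal hG
  obtain ⟨hCM, hiC, Y, hY, hCY⟩ := hC.prop
  have hSF := hno C hCM.1 hiC
  have hCY' : insert i C ⊂ Y := hCY.ssubset_of_ne fun e => hSF (e ▸ hY.1)
  obtain ⟨A, hA, ⟨hAF, Y', hY', hSY, h⟩ | ⟨hAF, Z, hZ, hZS, h⟩ | ⟨j₀, hj₀, hAF, Z, hZ, Y', hY', h⟩⟩ :=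
    exists_antichain_of_containsCopy hP₁ hP₂ hF.1 (hF.2 _ hSF)
  · exact hF.1 (containsCopy_of_antichain hAF hA hCM hY'
      (fun j => (subset_insert i C).trans_ssubset (h j).1) (fun j => (h j).2)
      ((subset_insert i C).trans_ssubset hSY))
  · exact hF.1 (containsCopy_of_antichain hAF hA hZ hY (fun j => (h j).1)
      (fun j => (h j).2.trans hCY') (hZS.trans hCY'))
  · have hSY : insert i C ⊂ Y' := hj₀ ▸ (h j₀).2
    have hCA : ∀ j, j ≠ j₀ → ¬ C ⊆ A j := by
      intro j hj hsub
      have hiA : i ∉ A j := fun hiA => hj (hA j₀ j (hj₀ ▸ insert_subset hiA hsub)).symm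
      have hAG : A j ∈ G := ⟨Mzero_mono hZ (hAF j hj) (h j).1.1, hiA, Y', hY',
        insert_subset (hSY.1 (mem_insert_self i C)) (h j).2.1⟩
      have hCeq : C = A j := hC.eq_of_le hAG hsub
      exact hj (hA j j₀ (hj₀ ▸ hCeq ▸ subset_insert i C))
    have hAC : ∀ j, j ≠ j₀ → ¬ A j ⊆ C := fun j hj hsub =>
      hj (hA j j₀ (hj₀ ▸ hsub.trans (subset_insert i C)))
    obtain ⟨M, hM, hMZ⟩ := exists_mem_Mfam_subset hZ
    have hMC : M ⊂ C := by
      refine ((subset_insert_iff_of_notMem (hi M hM)).mp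
        (hMZ.trans (hj₀ ▸ (h j₀).1.1))).ssubset_of_ne fun e => ?_
      obtain ⟨j, hj⟩ := exists_ne j₀
      exact hCA j hj (e ▸ hMZ.trans (h j).1.1)
    have hCY'' : C ⊂ Y' := (subset_insert i C).trans_ssubset hSY
    refine hF.1 (containsCopy_of_antichain (A := Function.update A j₀ C) (fun j => ?_)
      (fun j l hjl => ?_) hM.1 hY' (fun j => ?_) (fun j => ?_) (hMC.trans hCY''))
    · by_cases hj : j = j₀
      · simpa [hj] using hCM.1
      · simpa [hj] using hAF j hj
    · by_cases hj : j = j₀ <;> by_cases hl : l = j₀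
      · exact hj.trans hl.symm
      · exact absurd (by simpa [hj, hl] using hjl) (hCA l hl)
      · exact absurd (by simpa [hj, hl] using hjl) (hAC j hj)
      · exact hA j l (by simpa [hj, hl] using hjl)
    · by_cases hj : j = j₀
      · simpa [hj] using hMC
      · simpa [hj] using hMZ.trans_ssubset (h j).1
    · by_cases hj : j = j₀
      · simpa [hj] using hCY''
      · simpa [hj] using (h j).2

theorem lt_ncard_add_card_of_isSaturated [Fintype P₁] [Fintype P₂] (hk : 2 ≤ k)
    (hP₁ : ∃! a : P₁, IsMin a) (hP₂ : ∃! a : P₂, IsMax a)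
    (hF : IsSaturated (P₂ ⊕ₗ (AC k ⊕ₗ P₁)) F) (hcard : F.card < n) :
    n < {i : Fin n | ∃ M ∈ Mfam P₂ F, i ∈ M}.ncard + F.card := by
  classical
  have hne := Mzero_nonempty_of_isSaturated hk hP₁ hP₂ hF hcard
  have hlt := card_lt_card_of_forall_insert_mem
    (univ.filter fun i => ¬ ∃ M ∈ Mfam P₂ F, i ∈ M) F ⟨_, hne.some_mem.1⟩ fun i hi =>
      exists_insert_mem_of_forall_notMem hk hP₁ hP₂ hF hne (by simpa using hi)
  have hsum := card_filter_add_card_filter_not (s := (univ : Finset (Fin n)))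
    (fun i => ∃ M ∈ Mfam P₂ F, i ∈ M)
  rw [card_univ, Fintype.card_fin] at hsum
  have hncard : {i : Fin n | ∃ M ∈ Mfam P₂ F, i ∈ M}.ncard =
      (univ.filter fun i => ∃ M ∈ Mfam P₂ F, i ∈ M).card := by
    rw [← Set.ncard_coe_finset]
    simp
  omega

end Saturated

/-- Lemma: main preliminary lemma. -/
theorem statement4 {n : ℕ} (P₁ P₂ : Type) [PartialOrder P₁] [PartialOrder P₂]
    [Fintype P₁] [Fintype P₂]
    (k : ℕ) (hk : 2 ≤ k)
    (hP₁ : ∃! a : P₁, IsMin a) (hP₂ : ∃! a : P₂, IsMax a)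
    (F : Finset (Finset (Fin n)))
    (hF : IsSaturated (P₂ ⊕ₗ (AC k ⊕ₗ P₁)) F)
    (hcard : F.card < n) :
    ((n : ℝ) + 1 - F.card) / 2 ≤ ({i : Fin n | ∃ M ∈ Mfam P₂ F, i ∈ M}.ncard : ℝ) ∨
    ((n : ℝ) + 1 - F.card) / 2 ≤ ({i : Fin n | ∃ N ∈ Nfam P₁ F, i ∉ N}.ncard : ℝ) := by
  left
  have h : (n : ℝ) + 1 ≤ {i : Fin n | ∃ M ∈ Mfam P₂ F, i ∈ M}.ncard + F.card := by
    exact_mod_cast lt_ncard_add_card_of_isSaturated hk hP₁ hP₂ hF hcard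
  have hcard' : (F.card : ℝ) < n := by exact_mod_cast hcard
  linarith
end

section
/- Let S ⊆ [n] with S ∉ ℒ ∪ 𝒩 and |S| ≥ |ℱ|. Then ℒ ∪ 𝒩 ∪ {S} contains an induced copy of C₂; that is, there exist two distinct members of ℒ ∪ 𝒩 ∪ {S}, one strictly contained in the other. -/
open Finset

/-- Sets `X` such that some `𝒮 ⊆ I` makes `𝒮 ∪ {X}` an induced copy of `•*𝒜_k*P₂`
with `X` as its (unique) maximal element. -/
def Lzero (P₂ : Type) [PartialOrder P₂] (k : ℕ) {n : ℕ}
    (I : Set (Finset (Fin n))) : Set (Finset (Fin n)) :=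
  {X | ∃ f : (P₂ ⊕ₗ (AC k ⊕ₗ Unit)) → Finset (Fin n),
      Function.Injective f ∧ (∀ a b, a ≤ b ↔ f a ⊆ f b) ∧
      f (toLex (Sum.inr (toLex (Sum.inr Unit.unit)))) = X ∧
      ∀ a, a ≠ toLex (Sum.inr (toLex (Sum.inr Unit.unit))) → f a ∈ I}

/-- `ℒ₁`: the minimal elements of `ℒ₀`. -/
def Lone (P₂ : Type) [PartialOrder P₂] (k : ℕ) {n : ℕ}
    (F : Finset (Finset (Fin n))) : Set (Finset (Fin n)) :=
  {X ∈ Lzero P₂ k (↑F : Set (Finset (Fin n))) |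
    ∀ Y ∈ Lzero P₂ k (↑F : Set (Finset (Fin n))), Y ⊆ X → Y = X}

/-- `ℒ`: members of `ℒ₁` containing no member of `𝒩`. -/
def Lfam (P₁ P₂ : Type) [PartialOrder P₁] [PartialOrder P₂] (k : ℕ) {n : ℕ}
    (F : Finset (Finset (Fin n))) : Set (Finset (Fin n)) :=
  {X ∈ Lone P₂ k F | ∀ N ∈ Nfam P₁ F, ¬ N ⊆ X}

/-- In a finite poset whose minimal element is unique, that element is the least one. -/
theorem exists_least_of_existsUnique_isMin {P : Type*} [PartialOrder P] [Finite P]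
    (h : ∃! a : P, IsMin a) : ∃ a : P, ∀ b, a ≤ b := by
  obtain ⟨a, -, huniq⟩ := h
  refine ⟨a, fun b => ?_⟩
  obtain ⟨m, hmb, hm⟩ := (Set.toFinite (Set.univ : Set P)).exists_le_minimal (Set.mem_univ b)
  rw [← huniq m fun c hc => hm.2 (Set.mem_univ c) hc]
  exact hmb

/-- Every member of `𝒩₀` lies below a member of `𝒩`. -/
theorem exists_mem_Nfam_superset {P₁ : Type} [PartialOrder P₁] {n : ℕ}
    {F : Finset (Finset (Fin n))} {A : Finset (Fin n)} (hA : A ∈ Nzero P₁ F) :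
    ∃ N ∈ Nfam P₁ F, A ⊆ N := by
  obtain ⟨N, hAN, hN⟩ := (Set.toFinite (Nzero P₁ F)).exists_le_maximal hA
  exact ⟨N, ⟨hN.1, fun B hB h => h.antisymm (hN.2 hB h)⟩, hAN⟩

/-- Every member of `ℒ₀` lies above a member of `ℒ ∪ 𝒩`. -/
theorem exists_mem_Lfam_union_Nfam_subset (P₁ : Type) {P₂ : Type} [PartialOrder P₁]
    [PartialOrder P₂] {k n : ℕ} {F : Finset (Finset (Fin n))} {X : Finset (Fin n)}
    (hX : X ∈ Lzero P₂ k (↑F : Set (Finset (Fin n)))) :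
    ∃ A ∈ Lfam P₁ P₂ k F ∪ Nfam P₁ F, A ⊆ X := by
  obtain ⟨Y, hYX, hY⟩ :=
    (Set.toFinite (Lzero P₂ k (↑F : Set (Finset (Fin n))))).exists_le_minimal hX
  by_cases h : ∃ N ∈ Nfam P₁ F, N ⊆ Y
  · obtain ⟨N, hN, hNY⟩ := h
    exact ⟨N, Or.inr hN, hNY.trans hYX⟩
  · push Not at h
    exact ⟨Y, Or.inl ⟨⟨hY.1, fun Z hZ hZY => hZY.antisymm (hY.2 hZ hZY)⟩, h⟩, hYX⟩

/-- A set outside a saturated family lies below a member of `𝒩` or above a member of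
`ℒ ∪ 𝒩`. -/
theorem IsSaturated.subset_Nfam_or_Lfam_union_Nfam_subset {P₁ P₂ : Type} [PartialOrder P₁]
    [PartialOrder P₂] [Finite P₁] {k n : ℕ} (hP₁ : ∃! a : P₁, IsMin a)
    {F : Finset (Finset (Fin n))} (hF : IsSaturated (P₂ ⊕ₗ (AC k ⊕ₗ P₁)) F)
    {T : Finset (Fin n)} (hT : T ∉ F) :
    (∃ N ∈ Nfam P₁ F, T ⊆ N) ∨ ∃ A ∈ Lfam P₁ P₂ k F ∪ Nfam P₁ F, A ⊆ T := by
  obtain ⟨p, hp⟩ := exists_least_of_existsUnique_isMin hP₁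
  obtain ⟨f, hinj, hmem, hle⟩ := hF.2 T hT
  obtain ⟨t, rfl⟩ : ∃ t, f t = T := by
    by_contra! h
    exact hF.1 ⟨f, hinj, fun a => (hmem a).resolve_left (h a), hle⟩
  have hmemF {a} (ha : a ≠ t) : f a ∈ F := (hmem a).resolve_left fun h => ha (hinj h)
  let ι : P₁ → P₂ ⊕ₗ (AC k ⊕ₗ P₁) := fun q => toLex (Sum.inr (toLex (Sum.inr q)))
  have hι (q r : P₁) : ι q ≤ ι r ↔ q ≤ r := by simp [ι]
  by_cases ht : ∃ q, t = ι q
  · obtain ⟨q, rfl⟩ := ht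
    let g : P₂ ⊕ₗ (AC k ⊕ₗ Unit) → P₂ ⊕ₗ (AC k ⊕ₗ P₁) := fun x =>
      toLex ((ofLex x).map id fun y => toLex ((ofLex y).map id fun _ => p))
    have hg (x y) : x ≤ y ↔ g x ≤ g y := by
      induction x using Lex.rec with | _ x
      induction y using Lex.rec with | _ y
      rcases x with x | x <;> rcases y with y | y
      · simp [g]
      · simp [g]
      · simp [g]
      · induction x using Lex.rec with | _ x
        induction y using Lex.rec with | _ y
        rcases x with x | x <;> rcases y with y | y <;> simp [g]
    have hginj : Function.Injective g := fun x y h =>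
      le_antisymm ((hg x y).2 h.le) ((hg y x).2 h.ge)
    obtain ⟨A, hA, hAp⟩ := exists_mem_Lfam_union_Nfam_subset P₁ (P₂ := P₂) (k := k) (F := F)
      (X := f (ι p)) ⟨f ∘ g, hinj.comp hginj, fun x y => (hg x y).trans (hle _ _), rfl, by
        rintro (x | x | x) hx
        · exact hmemF nofun
        · exact hmemF nofun
        · exact absurd rfl hx⟩
    exact Or.inr ⟨A, hA, hAp.trans ((hle _ _).1 ((hι _ _).2 (hp q)))⟩
  · push Not at ht
    have htp : t ≤ ι p := by
      rcases t with t | t | t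
      · exact Sum.Lex.inl_le_inr _ _
      · exact Sum.Lex.inr_le_inr_iff.2 (Sum.Lex.inl_le_inr _ _)
      · exact absurd rfl (ht t)
    have hN : f (ι p) ∈ Nzero P₁ F :=
      ⟨hmemF (ht p).symm, f ∘ ι,
        hinj.comp fun q r h => le_antisymm ((hι q r).1 h.le) ((hι r q).1 h.ge),
        fun q => ⟨hmemF (ht q).symm, (hle _ _).1 ((hι _ _).2 (hp q))⟩,
        fun q r => (hι q r).symm.trans (hle _ _)⟩
    obtain ⟨N, hN, hpN⟩ := exists_mem_Nfam_superset hN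
    exact Or.inl ⟨N, hN, ((hle _ _).1 htp).trans hpN⟩

/-- A member `S` of a family with at most `|S|` members has an element whose removal leaves
the collection of supersets in the family unchanged. -/
theorem Finset.exists_mem_forall_erase_subset {α : Type*} [DecidableEq α]
    {F : Finset (Finset α)} {S : Finset α} (hS : S ∈ F) (hcard : F.card ≤ S.card) :
    ∃ i ∈ S, ∀ A ∈ F, S.erase i ⊆ A → S ⊆ A := by
  have hex (A : Finset α) : ∃ j, ¬ S ⊆ A → j ∈ S ∧ j ∉ A := by
    by_cases h : S ⊆ A
    · have : S.Nonempty := card_pos.1 ((card_pos.2 ⟨S, hS⟩).trans_le hcard)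
      exact ⟨this.choose, fun h' => absurd h h'⟩
    · obtain ⟨j, hj⟩ := not_subset.1 h
      exact ⟨j, fun _ => hj⟩
  choose w hw using hex
  obtain ⟨i, hiS, hi⟩ := exists_mem_notMem_of_card_lt_card
    (card_image_le.trans_lt ((card_erase_lt_of_mem hS).trans_le hcard) :
      ((F.erase S).image w).card < S.card)
  refine ⟨i, hiS, fun A hA hsub => ?_⟩
  by_contra h
  have hAS : A ≠ S := fun e => h e.ge
  refine (hw A h).2 (hsub (mem_erase.2 ⟨fun e => hi ?_, (hw A h).1⟩))
  exact mem_image.2 ⟨A, mem_erase.2 ⟨hAS, hA⟩, e⟩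

/-- if `S ∉ ℒ ∪ 𝒩` and `|S| ≥ |ℱ|`, then `ℒ ∪ 𝒩 ∪ {S}` contains an induced
copy of `C₂`, i.e. two distinct members one strictly contained in the other. -/
theorem statement8 {n : ℕ} (P₁ P₂ : Type) [PartialOrder P₁] [PartialOrder P₂]
    [Fintype P₁] [Fintype P₂]
    (k : ℕ) (hk : 2 ≤ k)
    (hP₁ : ∃! a : P₁, IsMin a) (hP₂ : ∃! a : P₂, IsMax a)
    (F : Finset (Finset (Fin n)))
    (hF : IsSaturated (P₂ ⊕ₗ (AC k ⊕ₗ P₁)) F)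
    (S : Finset (Fin n)) (hS : S ∉ Lfam P₁ P₂ k F ∪ Nfam P₁ F) (hcard : F.card ≤ S.card) :
    ∃ A ∈ insert S (Lfam P₁ P₂ k F ∪ Nfam P₁ F),
      ∃ B ∈ insert S (Lfam P₁ P₂ k F ∪ Nfam P₁ F), A ⊂ B := by
  obtain ⟨T, hTS, hTF, hsup⟩ : ∃ T ⊆ S, T ∉ F ∧ ∀ A ∈ F, T ⊆ A → S ⊆ A := by
    by_cases hSF : S ∈ F
    · obtain ⟨i, hi, h⟩ := exists_mem_forall_erase_subset hSF hcard
      exact ⟨S.erase i, erase_subset i S,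
        fun hT => notMem_erase i S (h _ hT Subset.rfl hi), h⟩
    · exact ⟨S, Subset.rfl, hSF, fun _ _ h => h⟩
  have hne {A} (hA : A ∈ Lfam P₁ P₂ k F ∪ Nfam P₁ F) : A ≠ S := fun h => hS (h ▸ hA)
  rcases hF.subset_Nfam_or_Lfam_union_Nfam_subset hP₁ hTF with ⟨N, hN, hTN⟩ | ⟨A, hA, hAT⟩
  · exact ⟨S, Or.inl rfl, N, Or.inr (Or.inr hN),
      (hsup N hN.1.1 hTN).ssubset_of_ne (hne (Or.inr hN)).symm⟩
  · exact ⟨A, Or.inr hA, S, Or.inl rfl, (hAT.trans hTS).ssubset_of_ne (hne hA)⟩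
end
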